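/- Assume (∂²B)_v is negative semi-definite for every v ≠ 0, and that either B(v) ≤ 0 for all v ∈ V or B is linear. Then F_B⁻ := −B/Λ + √(B²/Λ² + F²/Λ) is a Minkowski norm on V: F_B⁻ is continuous and nonnegative on V, positively homogeneous of degree 1, F_B⁻(0) = 0 and F_B⁻(v) > 0 for every v ≠ 0, F_B⁻ is twice continuously differentiable on V ∖ {0}, and the second derivative of (F_B⁻)² at every v ≠ 0 is a positive definite bilinear form on V. -/

import Mathlib

/-- The reverse Fermat metric `F_B⁻ := −B/Λ + √(B²/Λ² + F²/Λ)`. -/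
noncomputable def fermatFBrev {V : Type*} (Λ : ℝ) (B F : V → ℝ) (v : V) : ℝ :=
  -(B v) / Λ + Real.sqrt ((B v) ^ 2 / Λ ^ 2 + (F v) ^ 2 / Λ)

/-- A function with a continuous second derivative on an open set is `C²` there. -/
theorem contDiffOn_two_of_hasFDerivAt {E G : Type*} [NormedAddCommGroup E] [NormedSpace ℝ E]
    [NormedAddCommGroup G] [NormedSpace ℝ G] {s : Set E} (hs : IsOpen s) {f : E → G}
    {f' : E → E →L[ℝ] G} {f'' : E → E →L[ℝ] E →L[ℝ] G}
    (hf : ∀ x ∈ s, HasFDerivAt f (f' x) x) (hf' : ∀ x ∈ s, HasFDerivAt f' (f'' x) x)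
    (hcont : ContinuousOn f'' s) : ContDiffOn ℝ 2 f s := by
  have h1 : ContDiffOn ℝ 1 f' s := by
    rw [show (1 : WithTop ℕ∞) = 0 + 1 by norm_num, contDiffOn_succ_iff_fderiv_of_isOpen hs]
    refine ⟨fun x hx => (hf' x hx).differentiableAt.differentiableWithinAt, by simp, ?_⟩
    rw [contDiffOn_zero]
    exact hcont.congr fun x hx => (hf' x hx).fderiv
  rw [show (2 : WithTop ℕ∞) = 1 + 1 by norm_num, contDiffOn_succ_iff_fderiv_of_isOpen hs]
  exact ⟨fun x hx => (hf x hx).differentiableAt.differentiableWithinAt, by simp,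
    h1.congr fun x hx => (hf x hx).fderiv⟩

section Homogeneous

variable {V : Type*} [NormedAddCommGroup V] [NormedSpace ℝ V] {f : V → ℝ}

theorem map_zero_of_posHomogeneous (hom : ∀ l : ℝ, 0 < l → ∀ v, f (l • v) = l * f v) :
    f 0 = 0 := by
  have h := hom 2 two_pos 0
  rw [smul_zero] at h
  linarith

/-- Euler's identity for positively homogeneous functions of degree one. -/
theorem HasFDerivAt.apply_self_of_posHomogeneous {f' : V →L[ℝ] ℝ} {v : V}
    (hf : HasFDerivAt f f' v) (hom : ∀ l : ℝ, 0 < l → ∀ v, f (l • v) = l * f v) :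
    f' v = f v := by
  have h1 : HasDerivAt (fun t : ℝ => t • v) v 1 := by
    simpa using (hasDerivAt_id (1 : ℝ)).smul_const v
  have h2 : HasDerivAt (fun t : ℝ => f (t • v)) (f' v) 1 :=
    HasFDerivAt.comp_hasDerivAt (1 : ℝ) (by simpa using hf) h1
  have h3 : HasDerivAt (fun t : ℝ => t * f v) (f v) 1 := by
    simpa using (hasDerivAt_id (1 : ℝ)).mul_const (f v)
  refine h2.unique (h3.congr_of_eventuallyEq ?_)
  filter_upwards [lt_mem_nhds one_pos] with t ht using hom t ht v

theorem differentiableAt_fderiv_of_contDiffAt_two {v : V} (hf : ContDiffAt ℝ 2 f v) :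
    DifferentiableAt ℝ (fderiv ℝ f) v :=
  (hf.fderiv_right (m := 1) (by norm_num)).differentiableAt (by norm_num)

/-- The second derivative of a positively homogeneous function of degree one is
degenerate in the radial direction. -/
theorem fderiv_fderiv_apply_self_of_posHomogeneous (hf : ContDiffOn ℝ 2 f {0}ᶜ)
    (hom : ∀ l : ℝ, 0 < l → ∀ v, f (l • v) = l * f v) {v : V} (hv : v ≠ 0) (u : V) :
    fderiv ℝ (fderiv ℝ f) v u v = 0 := by
  have hat : ∀ x : V, x ≠ 0 → ContDiffAt ℝ 2 f x := fun x hx =>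
    hf.contDiffAt (isOpen_compl_singleton.mem_nhds hx)
  have hd : ∀ x : V, x ≠ 0 → HasFDerivAt f (fderiv ℝ f x) x := fun x hx =>
    ((hat x hx).differentiableAt (by norm_num)).hasFDerivAt
  have h2 := (differentiableAt_fderiv_of_contDiffAt_two (hat v hv)).hasFDerivAt.clm_apply
    (hasFDerivAt_id v)
  have h3 : (fun x => fderiv ℝ f x (id x)) =ᶠ[nhds v] f := by
    filter_upwards [isOpen_compl_singleton.mem_nhds hv] with x hx
    exact (hd x hx).apply_self_of_posHomogeneous hom
  have h4 := congrArg (fun L : V →L[ℝ] ℝ => L u)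
    ((h2.congr_of_eventuallyEq h3.symm).unique (hd v hv))
  simpa using h4

/-- If a positive, positively homogeneous `C²` function has a second derivative that is positive
on the nonzero vectors of the kernel of its first derivative, then its square has a positive
definite second derivative. -/
theorem sq_fderiv_add_mul_fderiv_fderiv_pos (hf : ContDiffOn ℝ 2 f {0}ᶜ)
    (hom : ∀ l : ℝ, 0 < l → ∀ v, f (l • v) = l * f v) {v : V} (hv : v ≠ 0) (hpos : 0 < f v)
    (hker : ∀ w : V, w ≠ 0 → fderiv ℝ f v w = 0 → 0 < fderiv ℝ (fderiv ℝ f) v w w)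
    {u : V} (hu : u ≠ 0) :
    0 < fderiv ℝ f v u ^ 2 + f v * fderiv ℝ (fderiv ℝ f) v u u := by
  have hat : ContDiffAt ℝ 2 f v := hf.contDiffAt (isOpen_compl_singleton.mem_nhds hv)
  have hd : HasFDerivAt f (fderiv ℝ f v) v := (hat.differentiableAt (by norm_num)).hasFDerivAt
  have heuler := hd.apply_self_of_posHomogeneous hom
  have hrad := fderiv_fderiv_apply_self_of_posHomogeneous hf hom hv
  have hsymm : ∀ x y, fderiv ℝ (fderiv ℝ f) v x y = fderiv ℝ (fderiv ℝ f) v y x :=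
    (hat.isSymmSndFDerivAt (by simp)).eq
  obtain ⟨c, hc⟩ : ∃ c : ℝ, c = fderiv ℝ f v u / f v := ⟨_, rfl⟩
  obtain ⟨w, hw⟩ : ∃ w, w = u - c • v := ⟨_, rfl⟩
  have huw : u = w + c • v := by rw [hw]; abel
  have hcv : fderiv ℝ f v u = c * f v := by rw [hc]; field_simp
  have hfw : fderiv ℝ f v w = 0 := by rw [hw]; simp [heuler, hcv]
  have hsec : fderiv ℝ (fderiv ℝ f) v u u = fderiv ℝ (fderiv ℝ f) v w w := by
    rw [huw]
    simp [hrad, hsymm v w]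
  rw [hsec, hcv]
  by_cases hw0 : w = 0
  · have hc0 : c ≠ 0 := by
      rintro rfl
      exact hu (by rw [huw, hw0]; simp)
    have : 0 < (c * f v) ^ 2 := by positivity
    simpa [hw0] using this
  · have := mul_pos hpos (hker w hw0 hfw)
    positivity

end Homogeneous

section FermatMetric

variable {V : Type*} {Λ : ℝ} {B F : V → ℝ}

/-- The quadratic equation characterising the reverse Fermat metric. -/
theorem fermatFBrev_quadratic (hΛ : 0 < Λ) (v : V) :
    Λ * fermatFBrev Λ B F v ^ 2 + 2 * B v * fermatFBrev Λ B F v = F v ^ 2 := by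
  have h : 0 ≤ B v ^ 2 / Λ ^ 2 + F v ^ 2 / Λ := by positivity
  have hs := Real.sq_sqrt h
  unfold fermatFBrev
  generalize Real.sqrt (B v ^ 2 / Λ ^ 2 + F v ^ 2 / Λ) = s at hs
  have h2 : Λ ^ 2 * s ^ 2 = B v ^ 2 + Λ * F v ^ 2 := by rw [hs]; field_simp
  have h3 : Λ * (-(B v) / Λ + s) = -(B v) + Λ * s := by field_simp
  refine mul_left_cancel₀ hΛ.ne' ?_
  linear_combination (Λ * (-(B v) / Λ + s) + B v + Λ * s) * h3 + h2

theorem abs_div_le_sqrt (hΛ : 0 < Λ) (b c : ℝ) :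
    |b / Λ| ≤ Real.sqrt (b ^ 2 / Λ ^ 2 + c ^ 2 / Λ) := by
  rw [← Real.sqrt_sq_eq_abs, div_pow]
  exact Real.sqrt_le_sqrt (le_add_of_nonneg_right (by positivity))

theorem fermatFBrev_nonneg (hΛ : 0 < Λ) (v : V) : 0 ≤ fermatFBrev Λ B F v := by
  have h := (le_abs_self _).trans (abs_div_le_sqrt hΛ (B v) (F v))
  unfold fermatFBrev
  rw [neg_div]
  linarith

theorem fermatFBrev_pos (hΛ : 0 < Λ) {v : V} (hF : 0 < F v) : 0 < fermatFBrev Λ B F v := by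
  refine (fermatFBrev_nonneg hΛ v).lt_of_ne' fun h => ?_
  have := fermatFBrev_quadratic (B := B) (F := F) hΛ v
  rw [h] at this
  nlinarith [pow_pos hF 2]

theorem mul_fermatFBrev_add_pos (hΛ : 0 < Λ) {v : V} (hF : 0 < F v) :
    0 < Λ * fermatFBrev Λ B F v + B v := by
  have h : Λ * fermatFBrev Λ B F v + B v
      = Λ * Real.sqrt (B v ^ 2 / Λ ^ 2 + F v ^ 2 / Λ) := by
    unfold fermatFBrev
    field_simp
    ring
  rw [h]
  positivity

theorem fermatFBrev_smul [AddCommGroup V] [Module ℝ V]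
    (hB : ∀ l : ℝ, 0 < l → ∀ v, B (l • v) = l * B v)
    (hF : ∀ l : ℝ, 0 < l → ∀ v, F (l • v) = l * F v) (l : ℝ) (hl : 0 < l) (v : V) :
    fermatFBrev Λ B F (l • v) = l * fermatFBrev Λ B F v := by
  unfold fermatFBrev
  rw [hB l hl, hF l hl, show (l * B v) ^ 2 / Λ ^ 2 + (l * F v) ^ 2 / Λ
    = l ^ 2 * (B v ^ 2 / Λ ^ 2 + F v ^ 2 / Λ) by ring, Real.sqrt_mul (sq_nonneg l),
    Real.sqrt_sq hl.le]
  ring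

theorem contDiffOn_fermatFBrev [NormedAddCommGroup V] [NormedSpace ℝ V] (hΛ : 0 < Λ)
    {s : Set V} {n : WithTop ℕ∞} (hB : ContDiffOn ℝ n B s)
    (hF : ContDiffOn ℝ n (fun v => F v ^ 2) s) (hpos : ∀ v ∈ s, 0 < F v) :
    ContDiffOn ℝ n (fermatFBrev Λ B F) s := by
  refine (hB.neg.div_const Λ).add
    ((((hB.pow 2).div_const _).add (hF.div_const Λ)).sqrt fun v hv => ?_)
  have := hpos v hv
  positivity

variable [NormedAddCommGroup V] [NormedSpace ℝ V]

/-- On the kernel of its first derivative, the second derivative of the reverse Fermat metric is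
controlled by those of `F²` and `B`. -/
theorem fderiv_fderiv_fermatFBrev_of_mem_ker (hΛ : 0 < Λ) {s : Set V} (hs : IsOpen s)
    (hf : ContDiffOn ℝ 2 (fermatFBrev Λ B F) s)
    {B' F2' : V → V →L[ℝ] ℝ} {B'' g : V → V →L[ℝ] V →L[ℝ] ℝ}
    (hB' : ∀ v ∈ s, HasFDerivAt B (B' v) v) (hB'' : ∀ v ∈ s, HasFDerivAt B' (B'' v) v)
    (hF2' : ∀ v ∈ s, HasFDerivAt (fun w => F w ^ 2) (F2' v) v)
    (hg : ∀ v ∈ s, HasFDerivAt F2' ((2 : ℝ) • g v) v)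
    {v w : V} (hv : v ∈ s) (hw : fderiv ℝ (fermatFBrev Λ B F) v w = 0) :
    (Λ * fermatFBrev Λ B F v + B v) * fderiv ℝ (fderiv ℝ (fermatFBrev Λ B F)) v w w
      = g v w w - fermatFBrev Λ B F v * B'' v w w := by
  set f := fermatFBrev Λ B F with hfdef
  have hat : ∀ x ∈ s, ContDiffAt ℝ 2 f x := fun x hx => hf.contDiffAt (hs.mem_nhds hx)
  have hd : ∀ x ∈ s, HasFDerivAt f (fderiv ℝ f x) x := fun x hx =>
    ((hat x hx).differentiableAt (by norm_num)).hasFDerivAt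
  have hfirst : ∀ x ∈ s, (2 * Λ * f x + 2 * B x) * fderiv ℝ f x w + 2 * f x * B' x w
      = F2' x w := by
    intro x hx
    have h1 := (((hd x hx).mul (hd x hx)).const_mul Λ).add
      (((hB' x hx).const_mul 2).mul (hd x hx))
    have h2 : HasFDerivAt (fun w => F w ^ 2) _ x := h1.congr_of_eventuallyEq
      (Filter.Eventually.of_forall fun y => by
        have := fermatFBrev_quadratic (B := B) (F := F) hΛ y
        simp only [Pi.add_apply, Pi.mul_apply]
        rw [hfdef, ← this]
        ring)
    have h3 := congrArg (fun L : V →L[ℝ] ℝ => L w) (h2.unique (hF2' x hx))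
    simp at h3
    linear_combination h3
  have hdd := (differentiableAt_fderiv_of_contDiffAt_two (hat v hv)).hasFDerivAt
  have h1 := ((((hd v hv).const_mul (2 * Λ)).add ((hB' v hv).const_mul 2)).mul
      (hdd.clm_apply (hasFDerivAt_const w v))).add
    (((hd v hv).const_mul 2).mul ((hB'' v hv).clm_apply (hasFDerivAt_const w v)))
  have h2 := h1.congr_of_eventuallyEq (f₁ := fun x => F2' x w) (by
    filter_upwards [hs.mem_nhds hv] with x hx
    simpa using (hfirst x hx).symm)
  have h3 := congrArg (fun L : V →L[ℝ] ℝ => L w)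
    (h2.unique ((hg v hv).clm_apply (hasFDerivAt_const w v)))
  simp [hw] at h3
  linear_combination h3 / 2

end FermatMetric

/-- if `(∂²B)_v` is negative semi-definite for every `v ≠ 0` and either
`B ≤ 0` or `B` is linear, then `F_B⁻ = −B/Λ + √(B²/Λ² + F²/Λ)` is a Minkowski norm. -/
theorem fermat_FB_rev_is_minkowski_norm
    {V : Type*} [NormedAddCommGroup V] [NormedSpace ℝ V] [FiniteDimensional ℝ V]
    (Λ : ℝ) (hΛ : 0 < Λ)
    (B : V → ℝ) (B' : V → V →L[ℝ] ℝ) (B'' : V → V →L[ℝ] V →L[ℝ] ℝ)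
    (hBcont : Continuous B)
    (hBhom : ∀ l : ℝ, 0 < l → ∀ v, B (l • v) = l * B v)
    (hB' : ∀ v : V, v ≠ 0 → HasFDerivAt B (B' v) v)
    (hB'' : ∀ v : V, v ≠ 0 → HasFDerivAt B' (B'' v) v)
    (hB''cont : ContinuousOn B'' {0}ᶜ)
    (hB''symm : ∀ v : V, v ≠ 0 → ∀ u w : V, B'' v u w = B'' v w u)
    (F : V → ℝ) (F2' : V → V →L[ℝ] ℝ) (g : V → V →L[ℝ] V →L[ℝ] ℝ)
    (hFcont : Continuous F) (hFnonneg : ∀ v, 0 ≤ F v)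
    (hFhom : ∀ l : ℝ, 0 < l → ∀ v, F (l • v) = l * F v)
    (hFpos : ∀ v : V, v ≠ 0 → 0 < F v)
    (hF2' : ∀ v : V, v ≠ 0 → HasFDerivAt (fun w => (F w) ^ 2) (F2' v) v)
    (hg : ∀ v : V, v ≠ 0 → HasFDerivAt F2' ((2 : ℝ) • g v) v)
    (hgcont : ContinuousOn g {0}ᶜ)
    (hgsymm : ∀ v : V, v ≠ 0 → ∀ u w : V, g v u w = g v w u)
    (hgpos : ∀ v : V, v ≠ 0 → ∀ u : V, u ≠ 0 → 0 < g v u u)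
    (hnsd : ∀ v : V, v ≠ 0 → ∀ u : V, B'' v u u ≤ 0)
    (halt : (∀ v : V, B v ≤ 0) ∨ IsLinearMap ℝ B) :
    Continuous (fermatFBrev Λ B F) ∧
    (∀ v : V, 0 ≤ fermatFBrev Λ B F v) ∧
    (∀ l : ℝ, 0 < l → ∀ v : V, fermatFBrev Λ B F (l • v) = l * fermatFBrev Λ B F v) ∧
    fermatFBrev Λ B F 0 = 0 ∧
    (∀ v : V, v ≠ 0 → 0 < fermatFBrev Λ B F v) ∧
    ContDiffOn ℝ 2 (fermatFBrev Λ B F) {0}ᶜ ∧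
    ∃ (FB2' : V → V →L[ℝ] ℝ) (FB2'' : V → V →L[ℝ] V →L[ℝ] ℝ),
      (∀ v : V, v ≠ 0 → HasFDerivAt (fun w => (fermatFBrev Λ B F w) ^ 2) (FB2' v) v) ∧
      (∀ v : V, v ≠ 0 → HasFDerivAt FB2' (FB2'' v) v) ∧
      (∀ v : V, v ≠ 0 → ∀ u : V, u ≠ 0 → 0 < FB2'' v u u) := by
  have hBC : ContDiffOn ℝ 2 B {0}ᶜ :=
    contDiffOn_two_of_hasFDerivAt isOpen_compl_singleton hB' hB'' hB''cont
  have hFC : ContDiffOn ℝ 2 (fun v => F v ^ 2) {0}ᶜ :=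
    contDiffOn_two_of_hasFDerivAt isOpen_compl_singleton hF2' hg (hgcont.const_smul (2 : ℝ))
  have hC := contDiffOn_fermatFBrev hΛ hBC hFC hFpos
  have hhom := fermatFBrev_smul (Λ := Λ) hBhom hFhom
  have hpos : ∀ v : V, v ≠ 0 → 0 < fermatFBrev Λ B F v := fun v hv =>
    fermatFBrev_pos hΛ (hFpos v hv)
  have hker : ∀ v : V, v ≠ 0 → ∀ w : V, w ≠ 0 → fderiv ℝ (fermatFBrev Λ B F) v w = 0 →
      0 < fderiv ℝ (fderiv ℝ (fermatFBrev Λ B F)) v w w := by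
    intro v hv w hw hfw
    have h := fderiv_fderiv_fermatFBrev_of_mem_ker hΛ isOpen_compl_singleton hC hB' hB'' hF2' hg
      hv hfw
    refine pos_of_mul_pos_right (a := Λ * fermatFBrev Λ B F v + B v) ?_
      (mul_fermatFBrev_add_pos hΛ (hFpos v hv)).le
    rw [h]
    have := mul_nonneg (hpos v hv).le (neg_nonneg.2 (hnsd v hv w))
    linarith [hgpos v hv w hw]
  refine ⟨?_, fermatFBrev_nonneg hΛ, hhom, map_zero_of_posHomogeneous hhom, hpos, hC,
    fun v => (2 * fermatFBrev Λ B F v) • fderiv ℝ (fermatFBrev Λ B F) v,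
    fun v => (2 * fermatFBrev Λ B F v) • fderiv ℝ (fderiv ℝ (fermatFBrev Λ B F)) v
      + ((2 : ℝ) • fderiv ℝ (fermatFBrev Λ B F) v).smulRight (fderiv ℝ (fermatFBrev Λ B F) v),
    ?_, ?_, ?_⟩
  · unfold fermatFBrev
    fun_prop
  all_goals
    intro v hv
    have hat : ContDiffAt ℝ 2 (fermatFBrev Λ B F) v :=
      hC.contDiffAt (isOpen_compl_singleton.mem_nhds hv)
    have hd := (hat.differentiableAt (by norm_num)).hasFDerivAt
  · simpa using hd.pow 2
  · exact (hd.const_mul 2).smul (differentiableAt_fderiv_of_contDiffAt_two hat).hasFDerivAt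
  · intro u hu
    have h := sq_fderiv_add_mul_fderiv_fderiv_pos hC hhom hv (hpos v hv) (hker v hv) hu
    simp
    linarith
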